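/- (Proposition: complete form J^{(2ν,2)}_ℓ, even order m = 2ν.) Let ν ≥ 1, ℓ ≥ 0. Suppose given smooth totally symmetric tensor fields L_{(2N)i₁...i_r} for odd ranks r ∈ {1,3,…,2ν−1} and N = 0,…,ℓ, and L_{(2N−1)i₁...i_r} for even ranks r ∈ {2,4,…,2ν} and N = 1,…,ℓ+1, such that: (i) for N = 1,…,ℓ+1 the tensors L_{(2N−1)i₁...i_{2ν}} = −(1/(2N−1)) L_{(2N−2)(i₁...i_{2ν−1}|i_{2ν})} are (2ν)-th order generalized Killing tensors; (ii) for N = 1,…,ℓ+1: (L_{(2N−2)c}Q^c)_{,i₁} = 2(2N−1) L_{(2N−1)i₁i₂} Q^{i₂} − 2N(2N−1) L_{(2N)i₁}, the last term present only if N < ℓ+1; (iii) for ν > 1, N = 0,…,ℓ and even r ∈ {2,4,…,2ν−2}: L_{(2N)(i₁...i_{r−1}|i_r)} = (r+1) L_{(2N)i₁...i_r i_{r+1}} Q^{i_{r+1}} − (2N+1) L_{(2N+1)i₁...i_r}; (iv) for ν > 1, N = 1,…,ℓ+1 and odd r ∈ {3,5,…,2ν−1}: L_{(2N−1)(i₁...i_{r−1}|i_r)}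 = (r+1) L_{(2N−1)i₁...i_r i_{r+1}} Q^{i_{r+1}} − 2N L_{(2N)i₁...i_r}, the last term present only if N < ℓ+1. Then J = Σ_{odd r ≤ 2ν} Σ_{N=0}^{ℓ} t^{2N} L_{(2N)i₁...i_r} q̇^{i₁}⋯q̇^{i_r} + Σ_{even r ≤ 2ν} Σ_{N=1}^{ℓ+1} t^{2N−1} L_{(2N−1)i₁...i_r} q̇^{i₁}⋯q̇^{i_r} + Σ_{N=0}^{ℓ} (L_{(2N)c}Q^c) t^{2N+1}/(2N+1) is a first integral of q̈^a = −Γ^a_{bc}q̇^bq̇^c − Q^a (the last displayed sum contains, for N = ℓ, the term (L_{(2ℓ)c}Q^c) t^{2ℓ+1}/(2ℓ+1), which replaces the constant term s₀ t^{2ℓ+1}/(2ℓ+1) of the non-complete form). -/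

import Mathlib

noncomputable section
open scoped BigOperators

/-- Points of the configuration space `ℝ^D`. -/
abbrev Vec (D : ℕ) := Fin D → ℝ

/-- Connection coefficients: `Conn D Γ` with `Γ q a b c = Γ^a_{bc}(q)`. -/
abbrev Conn (D : ℕ) := Vec D → Fin D → Fin D → Fin D → ℝ

/-- Totally covariant `r`-tensor fields on `ℝ^D`. -/
abbrev Tens (D r : ℕ) := Vec D → (Fin r → Fin D) → ℝ

/-- Partial derivative `∂f/∂q^j`. -/
def pd {D : ℕ} (j : Fin D) (f : Vec D → ℝ) (q : Vec D) : ℝ :=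
  fderiv ℝ f q (Pi.single j 1)

/-- Covariant derivative `T_{i₁...i_r|j}` (the last slot is the derivative index `j`):
`T_{i₁...i_r|j} = ∂T_{i₁...i_r}/∂q^j − Σ_k Γ^s_{i_k j} T_{i₁...s...i_r}`. -/
def covTens {D r : ℕ} (Γ : Conn D) (T : Tens D r) : Tens D (r + 1) :=
  fun q idx =>
    pd (idx (Fin.last r)) (fun p => T p fun k => idx k.castSucc) q
      - ∑ k : Fin r, ∑ s : Fin D,
          Γ q s (idx k.castSucc) (idx (Fin.last r)) *
            T q (Function.update (fun l => idx l.castSucc) k s)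

/-- Symmetrization of a tensor over all of its indices. -/
def symT {D r : ℕ} (T : Tens D r) : Tens D r :=
  fun q idx => (r.factorial : ℝ)⁻¹ * ∑ σ : Equiv.Perm (Fin r), T q (idx ∘ σ)

/-- Totally symmetric tensor field. -/
def IsSymTens {D r : ℕ} (T : Tens D r) : Prop :=
  ∀ (q : Vec D) (idx : Fin r → Fin D) (σ : Equiv.Perm (Fin r)), T q (idx ∘ σ) = T q idx

/-- Smooth tensor field. -/
def SmoothTens {D r : ℕ} (T : Tens D r) : Prop :=
  ∀ idx : Fin r → Fin D, ContDiff ℝ (⊤ : ℕ∞) fun q => T q idx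

/-- Generalized Killing tensor of order `r` for the connection `Γ`:
`T_{(i₁...i_r|i_{r+1})} = 0`. -/
def IsGenKT {D r : ℕ} (Γ : Conn D) (T : Tens D r) : Prop :=
  ∀ q idx, symT (covTens Γ T) q idx = 0

/-- `q, v` solve `q̈^a = -Γ^a_{bc}(q) q̇^b q̇^c - Q^a(q)` on the set `s ⊆ ℝ`. -/
def IsSolutionOn {D : ℕ} (Γ : Conn D) (Q : Vec D → Fin D → ℝ)
    (s : Set ℝ) (q v : ℝ → Vec D) : Prop :=
  ∀ t ∈ s, ∀ a : Fin D,
    HasDerivAt (fun τ => q τ a) (v t a) t ∧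
    HasDerivAt (fun τ => v τ a)
      (-(∑ b, ∑ c, Γ (q t) a b c * v t b * v t c) - Q (q t) a) t

/-- `I(t,q,q̇)` is a first integral of the system: it is constant along every
(C²) solution defined on an open interval. -/
def FirstIntegral {D : ℕ} (Γ : Conn D) (Q : Vec D → Fin D → ℝ)
    (I : ℝ → Vec D → Vec D → ℝ) : Prop :=
  ∀ (a b : ℝ) (q v : ℝ → Vec D), IsSolutionOn Γ Q (Set.Ioo a b) q v →
    ∀ t₁ ∈ Set.Ioo a b, ∀ t₂ ∈ Set.Ioo a b,
      I t₁ (q t₁) (v t₁) = I t₂ (q t₂) (v t₂)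

/-- The contraction `L_c Q^c` of a rank-1 tensor with the generalized forces. -/
def dotQ {D : ℕ} (L : Tens D 1) (Q : Vec D → Fin D → ℝ) (q : Vec D) : ℝ :=
  ∑ c, L q (fun _ => c) * Q q c


/-- Full contraction of a tensor with the velocity. -/
def ctr {D r : ℕ} (T : (Fin r → Fin D) → ℝ) (v : Vec D) : ℝ :=
  ∑ idx : Fin r → Fin D, T idx * ∏ k, v (idx k)

/-- Contraction of one slot with the force. -/
def cQ {D r : ℕ} (T : (Fin (r + 1) → Fin D) → ℝ) (Q : Fin D → ℝ) (idx : Fin r → Fin D) : ℝ :=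
  ∑ j, T (Fin.snoc idx j) * Q j

lemma ctr_comp {D r : ℕ} (T : (Fin r → Fin D) → ℝ) (v : Vec D) (σ : Equiv.Perm (Fin r)) :
    ∑ idx : Fin r → Fin D, T (idx ∘ σ) * ∏ k, v (idx k) = ctr T v := by
  unfold ctr
  refine Fintype.sum_equiv (Equiv.arrowCongr σ.symm (Equiv.refl _)) _ _ ?_
  intro idx
  have h : (Equiv.arrowCongr σ.symm (Equiv.refl (Fin D))) idx = idx ∘ σ := by
    ext; simp [Equiv.arrowCongr]
  rw [h]
  congr 1
  exact (Equiv.prod_comp σ (fun k => v (idx k))).symm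

lemma ctr_symT {D r : ℕ} (T : Tens D r) (q v : Vec D) :
    ctr (symT T q) v = ctr (T q) v := by
  have : ctr (symT T q) v = (r.factorial : ℝ)⁻¹ * ∑ σ : Equiv.Perm (Fin r),
      ∑ idx : Fin r → Fin D, T q (idx ∘ σ) * ∏ k, v (idx k) := by
    unfold ctr symT
    rw [Finset.sum_comm, Finset.mul_sum]
    refine Finset.sum_congr rfl fun idx _ => ?_
    rw [mul_assoc, Finset.sum_mul]
  rw [this]
  simp only [ctr_comp]
  rw [Finset.sum_const, Finset.card_univ, Fintype.card_perm, Fintype.card_fin, nsmul_eq_mul,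
    ← mul_assoc, inv_mul_cancel₀ (by positivity), one_mul]

lemma sum_snoc {D r : ℕ} (F : (Fin (r + 1) → Fin D) → ℝ) :
    ∑ idx, F idx = ∑ idx : Fin r → Fin D, ∑ j, F (Fin.snoc idx j) := by
  rw [Finset.sum_comm, ← Fintype.sum_prod_type']
  exact (Fintype.sum_equiv (Fin.snocEquiv (fun _ : Fin (r + 1) => Fin D)) _ _
    (fun x => rfl)).symm

lemma ctr_succ {D r : ℕ} (T : (Fin (r + 1) → Fin D) → ℝ) (v : Vec D) :
    ctr T v = ∑ idx : Fin r → Fin D, ∑ j, T (Fin.snoc idx j) * ((∏ k, v (idx k)) * v j) := by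
  unfold ctr
  rw [sum_snoc]
  simp [Fin.prod_univ_castSucc]

lemma sum_update_swap {D r : ℕ} (k : Fin r) (F : (Fin r → Fin D) → Fin D → ℝ) :
    ∑ idx : Fin r → Fin D, ∑ s, F idx s
      = ∑ idx : Fin r → Fin D, ∑ s, F (Function.update idx k s) (idx k) := by
  rw [← Fintype.sum_prod_type', ← Fintype.sum_prod_type']
  let e : ((Fin r → Fin D) × Fin D) ≃ ((Fin r → Fin D) × Fin D) :=
    { toFun := fun p => (Function.update p.1 k p.2, p.1 k)
      invFun := fun p => (Function.update p.1 k p.2, p.1 k)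
      left_inv := fun p => by simp
      right_inv := fun p => by simp }
  exact (Fintype.sum_equiv e _ _ (fun x => rfl)).symm

lemma gamma_part {D r : ℕ} (k : Fin r) (g : Fin D → Fin D → Fin D → ℝ)
    (T : (Fin r → Fin D) → ℝ) (v : Vec D) :
    ∑ idx : Fin r → Fin D, ∑ s, ∑ a,
      g s (idx k) a * T (Function.update idx k s) * ((∏ l, v (idx l)) * v a)
    = ∑ idx : Fin r → Fin D, T idx * ((∏ l ∈ Finset.univ.erase k, v (idx l)) *
        ∑ b, ∑ c, g (idx k) b c * v b * v c) := by
  rw [sum_update_swap k]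
  refine Finset.sum_congr rfl fun idx _ => ?_
  rw [Finset.mul_sum, Finset.mul_sum]
  refine Finset.sum_congr rfl fun b _ => ?_
  rw [Finset.mul_sum, Finset.mul_sum]
  refine Finset.sum_congr rfl fun c _ => ?_
  rw [← Finset.mul_prod_erase Finset.univ (fun l => v (Function.update idx k b l))
    (Finset.mem_univ k)]
  have h : ∏ l ∈ Finset.univ.erase k, v (Function.update idx k b l)
      = ∏ l ∈ Finset.univ.erase k, v (idx l) := by
    refine Finset.prod_congr rfl fun l hl => ?_
    rw [Function.update_of_ne (Finset.ne_of_mem_erase hl)]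
  rw [h]
  simp
  ring

lemma force_part_last {D r : ℕ} (Q : Fin D → ℝ)
    (T : (Fin (r + 1) → Fin D) → ℝ) (v : Vec D) :
    ∑ idx : Fin (r + 1) → Fin D, T idx *
      ((∏ l ∈ Finset.univ.erase (Fin.last r), v (idx l)) * Q (idx (Fin.last r)))
    = ctr (cQ T Q) v := by
  rw [sum_snoc]
  unfold ctr cQ
  refine Finset.sum_congr rfl fun idx _ => ?_
  rw [Finset.sum_mul]
  refine Finset.sum_congr rfl fun j _ => ?_
  have h : (Finset.univ.erase (Fin.last r)) = Finset.univ.map Fin.castSuccEmb := by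
    ext x
    simp [Fin.exists_castSucc_eq]
  rw [h, Finset.prod_map]
  simp
  ring

lemma force_part {D r : ℕ} (k : Fin (r + 1)) (Q : Fin D → ℝ)
    (T : (Fin (r + 1) → Fin D) → ℝ) (v : Vec D)
    (hT : ∀ idx (σ : Equiv.Perm (Fin (r + 1))), T (idx ∘ σ) = T idx) :
    ∑ idx : Fin (r + 1) → Fin D, T idx *
      ((∏ l ∈ Finset.univ.erase k, v (idx l)) * Q (idx k))
    = ctr (cQ T Q) v := by
  rw [← force_part_last]
  let σ := Equiv.swap k (Fin.last r)
  refine Fintype.sum_equiv (Equiv.arrowCongr σ (Equiv.refl _)) _ _ ?_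
  intro idx
  have h : (Equiv.arrowCongr σ (Equiv.refl (Fin D))) idx = idx ∘ σ := by
    ext; simp [Equiv.arrowCongr, σ]
  rw [h, hT]
  congr 2
  · have h2 : Finset.univ.erase k = (Finset.univ.erase (Fin.last r)).map σ.toEmbedding := by
      rw [Finset.map_erase]
      simp [σ]
    rw [h2, Finset.prod_map]
    rfl
  · simp [σ]

lemma hasDerivAt_comp_pd {D : ℕ} (f : Vec D → ℝ) (hf : ContDiff ℝ (⊤ : ℕ∞) f)
    (q : ℝ → Vec D) (w : Vec D) (t : ℝ) (hq : ∀ a, HasDerivAt (fun τ => q τ a) (w a) t) :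
    HasDerivAt (fun τ => f (q τ)) (∑ a, pd a f (q t) * w a) t := by
  have h1 : HasDerivAt q w t := hasDerivAt_pi.2 hq
  have h2 : HasFDerivAt f (fderiv ℝ f (q t)) (q t) :=
    (hf.differentiable (by simp) (q t)).hasFDerivAt
  have h3 := h2.comp_hasDerivAt t h1
  refine h3.congr_deriv (Eq.symm ?_)
  unfold pd
  conv_rhs => rw [pi_eq_sum_univ' w, map_sum]
  refine Finset.sum_congr rfl fun a _ => ?_
  rw [map_smul, smul_eq_mul, mul_comm]

lemma deriv_ctr {D r : ℕ} (Γ : Conn D) (Q : Vec D → Fin D → ℝ) (T : Tens D (r + 1))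
    (hT : SmoothTens T) (hs : IsSymTens T) (q v : ℝ → Vec D) (t : ℝ)
    (hq : ∀ a, HasDerivAt (fun τ => q τ a) (v t a) t)
    (hv : ∀ a, HasDerivAt (fun τ => v τ a)
      (-(∑ b, ∑ c, Γ (q t) a b c * v t b * v t c) - Q (q t) a) t) :
    HasDerivAt (fun τ => ctr (T (q τ)) (v τ))
      (ctr (symT (covTens Γ T) (q t)) (v t) - ((r + 1 : ℕ) : ℝ) * ctr (cQ (T (q t)) (Q (q t))) (v t))
      t := by
  have h1 : ∀ idx : Fin (r + 1) → Fin D, HasDerivAt (fun τ => T (q τ) idx * ∏ k, v τ (idx k))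
      ((∑ a, pd a (fun p => T p idx) (q t) * v t a) * (∏ k, v t (idx k)) +
        T (q t) idx * ∑ k, (∏ l ∈ Finset.univ.erase k, v t (idx l)) •
          (-(∑ b, ∑ c, Γ (q t) (idx k) b c * v t b * v t c) - Q (q t) (idx k))) t := by
    intro idx
    refine HasDerivAt.mul (hasDerivAt_comp_pd _ (hT idx) q _ t hq) ?_
    exact HasDerivAt.fun_finsetProd (fun k _ => hv (idx k))
  have h2 := HasDerivAt.fun_sum (u := Finset.univ) (fun idx _ => h1 idx)
  refine h2.congr_deriv (Eq.symm ?_)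
  change ctr (symT (covTens Γ T) (q t)) (v t) - ((r + 1 : ℕ) : ℝ) * ctr (cQ (T (q t)) (Q (q t))) (v t) = _
  rw [ctr_symT, ctr_succ]
  have hF : ((r + 1 : ℕ) : ℝ) * ctr (cQ (T (q t)) (Q (q t))) (v t)
      = ∑ k : Fin (r + 1), ∑ idx : Fin (r + 1) → Fin D, T (q t) idx *
      ((∏ l ∈ Finset.univ.erase k, v t (idx l)) * Q (q t) (idx k)) := by
    simp only [force_part _ _ _ _ (hs (q t))]
    simp
  have hG : ∑ k : Fin (r + 1), ∑ idx : Fin (r + 1) → Fin D, ∑ s, ∑ a,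
      Γ (q t) s (idx k) a * T (q t) (Function.update idx k s) * ((∏ l, v t (idx l)) * v t a)
      = ∑ k : Fin (r + 1), ∑ idx : Fin (r + 1) → Fin D, T (q t) idx *
        ((∏ l ∈ Finset.univ.erase k, v t (idx l)) *
        ∑ b, ∑ c, Γ (q t) (idx k) b c * v t b * v t c) :=
    Finset.sum_congr rfl fun k _ => gamma_part k _ _ _
  have hK : ∑ idx : Fin (r + 1) → Fin D, ∑ j, covTens Γ T (q t) (Fin.snoc idx j) *
        ((∏ k, v t (idx k)) * v t j)
      = ∑ idx : Fin (r + 1) → Fin D, (∑ a, pd a (fun p => T p idx) (q t) * v t a) *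
          (∏ k, v t (idx k))
        - ∑ k : Fin (r + 1), ∑ idx : Fin (r + 1) → Fin D, ∑ s, ∑ a,
      Γ (q t) s (idx k) a * T (q t) (Function.update idx k s) * ((∏ l, v t (idx l)) * v t a) := by
    rw [Finset.sum_comm (s := (Finset.univ : Finset (Fin (r + 1)))), ← Finset.sum_sub_distrib]
    refine Finset.sum_congr rfl fun idx _ => ?_
    have e : ∀ k : Fin (r + 1), ∑ s, ∑ a,
        Γ (q t) s (idx k) a * T (q t) (Function.update idx k s) * ((∏ l, v t (idx l)) * v t a)
        = ∑ a, ∑ s, Γ (q t) s (idx k) a * T (q t) (Function.update idx k s) *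
          ((∏ l, v t (idx l)) * v t a) := fun k => Finset.sum_comm
    simp only [e]
    rw [Finset.sum_comm (s := (Finset.univ : Finset (Fin (r + 1)))), Finset.sum_mul,
      ← Finset.sum_sub_distrib]
    refine Finset.sum_congr rfl fun a _ => ?_
    simp only [covTens, Fin.snoc_last, Fin.snoc_castSucc, ← Finset.sum_mul]
    ring
  rw [hK, hG, hF, Finset.sum_add_distrib, sub_sub, sub_eq_add_neg]
  congr 1
  rw [← Finset.sum_add_distrib, ← Finset.sum_neg_distrib]
  simp only [Finset.mul_sum]
  rw [Finset.sum_comm (s := (Finset.univ : Finset (Fin (r + 1) → Fin D)))]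
  refine Finset.sum_congr rfl fun k _ => ?_
  rw [← Finset.sum_add_distrib, ← Finset.sum_neg_distrib]
  refine Finset.sum_congr rfl fun idx _ => ?_
  simp only [← Finset.mul_sum, smul_eq_mul]
  ring

lemma final_sum (ν ℓ : ℕ) (t : ℝ) (G W : ℕ → ℕ → ℝ)
    (hG : ∀ N, G N (2 * ν + 1) = 0) (hG2 : ∀ r, G (2 * (ℓ + 1)) r = 0)
    (hW : ∀ N, W N (2 * ν) = 0) (hW' : ∀ N, W N (2 * ν + 1) = 0) :
    (∑ j ∈ Finset.range ν, ∑ N ∈ Finset.range (ℓ + 1),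
      (((2 * N : ℕ) : ℝ) * t ^ (2 * N - 1) * G (2 * N) (2 * j + 1) +
        t ^ (2 * N) * ((((2 * j + 3 : ℕ) : ℝ) * W (2 * N) (2 * j + 2)
          - (2 * (N : ℝ) + 1) * G (2 * N + 1) (2 * j + 2))
          - ((2 * j + 1 : ℕ) : ℝ) * W (2 * N) (2 * j))))
    + (∑ j ∈ Finset.range ν, ∑ N ∈ Finset.range (ℓ + 1),
      (((2 * N + 1 : ℕ) : ℝ) * t ^ (2 * N) * G (2 * N + 1) (2 * j + 2) +
        t ^ (2 * N + 1) * ((((2 * j + 4 : ℕ) : ℝ) * W (2 * N + 1) (2 * j + 3)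
          - (2 * (N : ℝ) + 2) * G (2 * N + 2) (2 * j + 3))
          - ((2 * j + 2 : ℕ) : ℝ) * W (2 * N + 1) (2 * j + 1))))
    + ∑ N ∈ Finset.range (ℓ + 1), (t ^ (2 * N) * W (2 * N) 0 +
        t ^ (2 * N + 1) * (2 * W (2 * N + 1) 1 - (2 * (N : ℝ) + 2) * G (2 * N + 2) 1)) = 0 := by
  let g : ℕ → ℕ → ℝ := fun N j => ((2 * N : ℕ) : ℝ) * t ^ (2 * N - 1) * G (2 * N) (2 * j + 1)
  have hA : ∀ N, ∑ j ∈ Finset.range ν, (((2 * (j + 1) + 1 : ℕ) : ℝ) * W (2 * N) (2 * (j + 1))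
      - ((2 * j + 1 : ℕ) : ℝ) * W (2 * N) (2 * j)) = - W (2 * N) 0 := by
    intro N
    rw [Finset.sum_range_sub (fun j => ((2 * j + 1 : ℕ) : ℝ) * W (2 * N) (2 * j))]
    simp [hW]
  have hB : ∀ N, ∑ j ∈ Finset.range ν,
      (((2 * (j + 1) + 2 : ℕ) : ℝ) * W (2 * N + 1) (2 * (j + 1) + 1)
      - ((2 * j + 2 : ℕ) : ℝ) * W (2 * N + 1) (2 * j + 1)) = - (2 * W (2 * N + 1) 1) := by
    intro N
    rw [Finset.sum_range_sub (fun j => ((2 * j + 2 : ℕ) : ℝ) * W (2 * N + 1) (2 * j + 1))]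
    simp [hW']
  have hC : ∀ N, ∑ j ∈ Finset.range ν, (g (N + 1) (j + 1) - g (N + 1) j) = - g (N + 1) 0 := by
    intro N
    rw [Finset.sum_range_sub (fun j => g (N + 1) j)]
    simp [g, hG]
  have hD : ∀ j, ∑ N ∈ Finset.range (ℓ + 1), (g (N + 1) j - g N j) = 0 := by
    intro j
    rw [Finset.sum_range_sub (fun N => g N j)]
    simp [g, hG2]
  have hD' : ∑ N ∈ Finset.range (ℓ + 1), ∑ j ∈ Finset.range ν, (g (N + 1) j - g N j) = 0 := by
    rw [Finset.sum_comm]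
    simp [hD]
  rw [Finset.sum_comm, Finset.sum_comm (s := Finset.range ν) (t := Finset.range (ℓ + 1)),
    ← Finset.sum_add_distrib, ← Finset.sum_add_distrib]
  rw [← neg_eq_zero, ← Finset.sum_neg_distrib, ← hD']
  refine Finset.sum_congr rfl fun N _ => ?_
  have e1 := hA N
  have e2 := hB N
  have e3 := hC N
  have e0 : t ^ (2 * N + 1) * (2 * (N : ℝ) + 2) * G (2 * N + 2) 1 = g (N + 1) 0 := by
    simp only [g]
    rw [show 2 * (N + 1) - 1 = 2 * N + 1 by omega]
    push_cast
    ring_nf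
  have e4 : - (W (2 * N) 0) = ∑ j ∈ Finset.range ν,
    (((2 * (j + 1) + 1 : ℕ) : ℝ) * W (2 * N) (2 * (j + 1))
      - ((2 * j + 1 : ℕ) : ℝ) * W (2 * N) (2 * j)) := e1.symm
  have key : (t ^ (2 * N) * W (2 * N) 0 +
        t ^ (2 * N + 1) * (2 * W (2 * N + 1) 1 - (2 * (N : ℝ) + 2) * G (2 * N + 2) 1))
      = ∑ j ∈ Finset.range ν, (- t ^ (2 * N) * (((2 * (j + 1) + 1 : ℕ) : ℝ) * W (2 * N) (2 * (j + 1))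
      - ((2 * j + 1 : ℕ) : ℝ) * W (2 * N) (2 * j))
      - t ^ (2 * N + 1) * (((2 * (j + 1) + 2 : ℕ) : ℝ) * W (2 * N + 1) (2 * (j + 1) + 1)
      - ((2 * j + 2 : ℕ) : ℝ) * W (2 * N + 1) (2 * j + 1)) + (g (N + 1) (j + 1) - g (N + 1) j)) := by
    rw [Finset.sum_add_distrib, Finset.sum_sub_distrib, ← Finset.mul_sum, ← Finset.mul_sum,
      e1, e2, e3, ← e0]
    ring
  rw [key, ← Finset.sum_add_distrib, ← Finset.sum_add_distrib, ← Finset.sum_neg_distrib]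
  refine Finset.sum_congr rfl fun j _ => ?_
  simp only [g]
  rw [show 2 * (N + 1) - 1 = 2 * N + 1 by omega, show 2 * (j + 1) = 2 * j + 2 by ring,
    show 2 * (N + 1) = 2 * N + 2 by ring]
  push_cast
  ring

/-- Rewriting of a sum over `1..n+1`. -/
lemma sum_Icc_shift (n : ℕ) (f : ℕ → ℝ) :
    ∑ N ∈ Finset.Icc 1 (n + 1), f N = ∑ N ∈ Finset.range (n + 1), f (N + 1) := by
  rw [Finset.range_eq_Ico, Finset.sum_Ico_add' f 0 (n + 1) 1]
  rfl

lemma ctr_zero' {D r : ℕ} (v : Vec D) : ctr (fun _ : Fin r → Fin D => (0 : ℝ)) v = 0 := by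
  simp [ctr]

lemma ctr_cQ_zero {D r : ℕ} (Q v : Vec D) :
    ctr (cQ (fun _ : Fin (r + 1) → Fin D => (0 : ℝ)) Q) v = 0 := by
  simp [ctr, cQ]

lemma ctr_lin {D r : ℕ} (A B C : (Fin r → Fin D) → ℝ) (x y : ℝ) (v : Vec D)
    (h : ∀ idx, A idx = x * B idx - y * C idx) : ctr A v = x * ctr B v - y * ctr C v := by
  unfold ctr
  rw [Finset.mul_sum, Finset.mul_sum, ← Finset.sum_sub_distrib]
  refine Finset.sum_congr rfl fun idx _ => ?_
  rw [h]
  ring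

lemma sum_fin_one {D : ℕ} (F : (Fin 1 → Fin D) → ℝ) :
    ∑ idx, F idx = ∑ i, F (fun _ => i) :=
  (Fintype.sum_equiv (Equiv.funUnique (Fin 1) (Fin D)).symm _ _ (fun _ => rfl)).symm

lemma ctr_sum {D r : ℕ} (s : Finset ℕ) (c : ℕ → ℝ) (T : ℕ → (Fin r → Fin D) → ℝ) (v : Vec D) :
    ∑ idx : Fin r → Fin D, (∑ N ∈ s, c N * T N idx) * ∏ k, v (idx k)
      = ∑ N ∈ s, c N * ctr (T N) v := by
  unfold ctr
  simp only [Finset.mul_sum, Finset.sum_mul]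
  rw [Finset.sum_comm]
  simp only [mul_assoc]

/-- complete form `J^{(2ν,2)}_ℓ`, even order `m = 2ν`.
`L N r` represents `L_{(N)i₁...i_r}`.  The admissible components are
`L_{(2N)}` at odd ranks `r ∈ {1,…,2ν−1}` with `0 ≤ N ≤ ℓ` and `L_{(2N−1)}` at
even ranks `r ∈ {2,…,2ν}` with `1 ≤ N ≤ ℓ+1`; all other components are absent,
i.e. vanish, which encodes the "present only if" conventions. -/
theorem stmt8 {D : ℕ} (ν ℓ : ℕ) (hν : 1 ≤ ν)
    (Γ : Conn D) (Q : Vec D → Fin D → ℝ)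
    (hΓsym : ∀ q a b c, Γ q a b c = Γ q a c b)
    (hΓ : ∀ a b c, ContDiff ℝ (⊤ : ℕ∞) fun q => Γ q a b c)
    (hQ : ∀ a, ContDiff ℝ (⊤ : ℕ∞) fun q => Q q a)
    (L : ℕ → (r : ℕ) → Tens D r)
    (hLsm : ∀ N r, SmoothTens (L N r))
    (hLsym : ∀ N r, IsSymTens (L N r))
    (hL0 : ∀ N r, r = 0 ∨ 2 * ν < r ∨ 2 * ℓ + 1 < N ∨ N % 2 = r % 2 →
      L N r = fun _ _ => 0)
    -- (i) for `N = 1,…,ℓ+1`: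
    -- `L_{(2N−1)i₁...i_{2ν}} = −(1/(2N−1)) L_{(2N−2)(i₁...i_{2ν−1}|i_{2ν})}` are (2ν)-th order KTs
    (hrec : ∀ ν₀, ν = ν₀ + 1 → ∀ N, 1 ≤ N → N ≤ ℓ + 1 →
      (∀ q (idx : Fin (2 * ν₀ + 2) → Fin D),
        L (2 * N - 1) (2 * ν₀ + 2) q idx =
          -(1 / (2 * (N : ℝ) - 1)) * symT (covTens Γ (L (2 * N - 2) (2 * ν₀ + 1))) q idx) ∧
      IsGenKT Γ (L (2 * N - 1) (2 * ν₀ + 2)))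
    -- (ii) `(L_{(2N−2)c}Q^c)_{,i₁} = 2(2N−1) L_{(2N−1)i₁i₂}Q^{i₂} − 2N(2N−1) L_{(2N)i₁}`,
    -- `N = 1,…,ℓ+1` (the last term only if `N < ℓ+1`)
    (hc1 : ∀ N, 1 ≤ N → N ≤ ℓ + 1 → ∀ q (i : Fin D),
      pd i (dotQ (L (2 * N - 2) 1) Q) q =
        2 * (2 * (N : ℝ) - 1) * (∑ j, L (2 * N - 1) 2 q ![i, j] * Q q j)
          - 2 * (N : ℝ) * (2 * (N : ℝ) - 1) * L (2 * N) 1 q fun _ => i)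
    -- (iii) for even ranks `r = 2i+2 ∈ {2,…,2ν−2}` and `N = 0,…,ℓ`
    (hc2 : ∀ N, N ≤ ℓ → ∀ i : ℕ, 2 * i + 4 ≤ 2 * ν →
      ∀ q (idx : Fin (2 * i + 2) → Fin D),
        symT (covTens Γ (L (2 * N) (2 * i + 1))) q idx =
          ((2 * i + 3 : ℕ) : ℝ) * (∑ j, L (2 * N) (2 * i + 3) q (Fin.snoc idx j) * Q q j)
            - (2 * (N : ℝ) + 1) * L (2 * N + 1) (2 * i + 2) q idx)
    -- (iv) for odd ranks `r = 2i+3 ∈ {3,…,2ν−1}` and `N = 1,…,ℓ+1`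
    (hc3 : ∀ N, 1 ≤ N → N ≤ ℓ + 1 → ∀ i : ℕ, 2 * i + 4 ≤ 2 * ν →
      ∀ q (idx : Fin (2 * i + 3) → Fin D),
        symT (covTens Γ (L (2 * N - 1) (2 * i + 2))) q idx =
          ((2 * i + 4 : ℕ) : ℝ) * (∑ j, L (2 * N - 1) (2 * i + 4) q (Fin.snoc idx j) * Q q j)
            - 2 * (N : ℝ) * L (2 * N) (2 * i + 3) q idx) :
    FirstIntegral Γ Q (fun t q v =>
      (∑ j ∈ Finset.range ν, ∑ idx : Fin (2 * j + 1) → Fin D,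
        (∑ N ∈ Finset.range (ℓ + 1), t ^ (2 * N) * L (2 * N) (2 * j + 1) q idx) *
          ∏ k : Fin (2 * j + 1), v (idx k))
      + (∑ j ∈ Finset.range ν, ∑ idx : Fin (2 * j + 2) → Fin D,
        (∑ N ∈ Finset.Icc 1 (ℓ + 1), t ^ (2 * N - 1) * L (2 * N - 1) (2 * j + 2) q idx) *
          ∏ k : Fin (2 * j + 2), v (idx k))
      + (∑ N ∈ Finset.range (ℓ + 1),
          dotQ (L (2 * N) 1) Q q * t ^ (2 * N + 1) / ((2 * N + 1 : ℕ) : ℝ))) := by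
  intro a b q v hsol
  have hQ0 : ∀ N q v, ctr (cQ (L N 1 q) (Q q)) v = dotQ (L N 1) Q q := by
    intro N q v
    simp only [ctr, cQ, dotQ, Finset.univ_unique, Finset.sum_singleton, Finset.univ_eq_empty,
      Finset.prod_empty, mul_one]
    refine Finset.sum_congr rfl fun j _ => ?_
    congr 2
  -- uniform versions of the conditions
  have k2 : ∀ N, N ≤ ℓ → ∀ j, j < ν → ∀ q v,
      ctr (symT (covTens Γ (L (2 * N) (2 * j + 1))) q) v =
        ((2 * j + 3 : ℕ) : ℝ) * ctr (cQ (L (2 * N) (2 * j + 3) q) (Q q)) v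
          - (2 * (N : ℝ) + 1) * ctr (L (2 * N + 1) (2 * j + 2) q) v := by
    intro N hN j hj q v
    apply ctr_lin
    intro idx
    by_cases hj' : 2 * j + 4 ≤ 2 * ν
    · exact hc2 N hN j hj' q idx
    · have h := (hrec j (by omega) (N + 1) (by omega) (by omega)).1 q idx
      rw [show 2 * (N + 1) - 1 = 2 * N + 1 by omega, show 2 * (N + 1) - 2 = 2 * N by omega] at h
      have hz : L (2 * N) (2 * j + 3) = fun _ _ => 0 := hL0 _ _ (by omega)
      rw [h, hz]
      have hp : (2 * (N : ℝ) + 1) ≠ 0 := by positivity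
      have hp' : 2 * ((N + 1 : ℕ) : ℝ) - 1 = 2 * (N : ℝ) + 1 := by push_cast; ring
      rw [hp']
      simp only [cQ, zero_mul, Finset.sum_const_zero, mul_zero]
      field_simp
      ring
  have k3 : ∀ N, N ≤ ℓ → ∀ j, j < ν → ∀ q v,
      ctr (symT (covTens Γ (L (2 * N + 1) (2 * j + 2))) q) v =
        ((2 * j + 4 : ℕ) : ℝ) * ctr (cQ (L (2 * N + 1) (2 * j + 4) q) (Q q)) v
          - (2 * (N : ℝ) + 2) * ctr (L (2 * N + 2) (2 * j + 3) q) v := by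
    intro N hN j hj q v
    apply ctr_lin
    intro idx
    by_cases hj' : 2 * j + 4 ≤ 2 * ν
    · have h := hc3 (N + 1) (by omega) (by omega) j hj' q idx
      rw [show 2 * (N + 1) - 1 = 2 * N + 1 by omega, show 2 * (N + 1) = 2 * N + 2 by omega] at h
      rw [h]
      simp only [cQ]
      push_cast
      ring
    · have h := (hrec j (by omega) (N + 1) (by omega) (by omega)).2 q idx
      rw [show 2 * (N + 1) - 1 = 2 * N + 1 by omega] at h
      have hz : L (2 * N + 1) (2 * j + 4) = fun _ _ => 0 := hL0 _ _ (by omega)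
      have hz' : L (2 * N + 2) (2 * j + 3) = fun _ _ => 0 := hL0 _ _ (by omega)
      rw [h, hz, hz']
      simp [cQ]
  have k1 : ∀ N, N ≤ ℓ → ∀ q v,
      (∑ i, pd i (dotQ (L (2 * N) 1) Q) q * v i) / ((2 * N + 1 : ℕ) : ℝ) =
        2 * ctr (cQ (L (2 * N + 1) 2 q) (Q q)) v
          - (2 * (N : ℝ) + 2) * ctr (L (2 * N + 2) 1 q) v := by
    intro N hN q v
    have hp : (2 * (N : ℝ) + 1) ≠ 0 := by positivity
    unfold ctr
    rw [sum_fin_one, sum_fin_one, Finset.mul_sum, Finset.mul_sum, ← Finset.sum_sub_distrib,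
      Finset.sum_div]
    refine Finset.sum_congr rfl fun i _ => ?_
    have h := hc1 (N + 1) (by omega) (by omega) q i
    rw [show 2 * (N + 1) - 1 = 2 * N + 1 by omega, show 2 * (N + 1) - 2 = 2 * N by omega,
      show 2 * (N + 1) = 2 * N + 2 by omega] at h
    have hc : cQ (L (2 * N + 1) 2 q) (Q q) (fun _ : Fin 1 => i)
        = ∑ j, L (2 * N + 1) 2 q ![i, j] * Q q j := by
      unfold cQ
      refine Finset.sum_congr rfl fun j _ => ?_
      congr 2
      funext k
      fin_cases k <;> rfl
    rw [h, hc]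
    simp only [Finset.univ_unique, Finset.prod_singleton]
    push_cast
    field_simp
    ring
  -- derivative
  have hder : ∀ t ∈ Set.Ioo a b, HasDerivAt (fun t =>
      (∑ j ∈ Finset.range ν, ∑ N ∈ Finset.range (ℓ + 1),
        t ^ (2 * N) * ctr (L (2 * N) (2 * j + 1) (q t)) (v t))
      + (∑ j ∈ Finset.range ν, ∑ N ∈ Finset.range (ℓ + 1),
        t ^ (2 * N + 1) * ctr (L (2 * N + 1) (2 * j + 2) (q t)) (v t))
      + (∑ N ∈ Finset.range (ℓ + 1),
          dotQ (L (2 * N) 1) Q (q t) * t ^ (2 * N + 1) / ((2 * N + 1 : ℕ) : ℝ))) 0 t := by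
    intro t ht
    have hq := fun c => (hsol t ht c).1
    have hv := fun c => (hsol t ht c).2
    have hG := fun N r => deriv_ctr Γ Q (L N (r + 1)) (hLsm N (r + 1)) (hLsym N (r + 1)) q v t hq hv
    have hdot : ∀ N, ContDiff ℝ (⊤ : ℕ∞) (dotQ (L N 1) Q) := by
      intro N
      unfold dotQ
      exact ContDiff.sum fun c _ => (hLsm N 1 _).mul (hQ c)
    have d1 := HasDerivAt.fun_sum (u := Finset.range ν) fun j _ =>
      HasDerivAt.fun_sum (u := Finset.range (ℓ + 1)) fun N _ =>
        (hasDerivAt_pow (2 * N) t).fun_mul (hG (2 * N) (2 * j))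
    have d2 := HasDerivAt.fun_sum (u := Finset.range ν) fun j _ =>
      HasDerivAt.fun_sum (u := Finset.range (ℓ + 1)) fun N _ =>
        (hasDerivAt_pow (2 * N + 1) t).fun_mul (hG (2 * N + 1) (2 * j + 1))
    have d3 := HasDerivAt.fun_sum (u := Finset.range (ℓ + 1)) fun N _ =>
      ((hasDerivAt_comp_pd _ (hdot (2 * N)) q _ t hq).fun_mul
        (hasDerivAt_pow (2 * N + 1) t)).div_const ((2 * N + 1 : ℕ) : ℝ)
    refine ((d1.fun_add d2).fun_add d3).congr_deriv ?_
    have hf := final_sum ν ℓ t (fun N r => ctr (L N r (q t)) (v t))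
      (fun N r => ctr (cQ (L N (r + 1) (q t)) (Q (q t))) (v t))
      (fun N => by
        have hz : L N (2 * ν + 1) = fun _ _ => 0 := hL0 _ _ (by omega)
        simp only [hz, ctr_zero'])
      (fun r => by
        have hz : L (2 * (ℓ + 1)) r = fun _ _ => 0 := hL0 _ _ (by omega)
        simp only [hz, ctr_zero'])
      (fun N => by
        have hz : L N (2 * ν + 1) = fun _ _ => 0 := hL0 _ _ (by omega)
        simp only [hz, ctr_cQ_zero])
      (fun N => by
        have hz : L N (2 * ν + 1 + 1) = fun _ _ => 0 := hL0 _ _ (by omega)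
        simp only [hz, ctr_cQ_zero])
    rw [← hf]
    congr 1
    · congr 1
      · refine Finset.sum_congr rfl fun j hj => Finset.sum_congr rfl fun N hN => ?_
        rw [k2 N (by simp at hN; omega) j (by simpa using hj)]
      · refine Finset.sum_congr rfl fun j hj => Finset.sum_congr rfl fun N hN => ?_
        rw [k3 N (by simp at hN; omega) j (by simpa using hj)]
        simp only [Nat.add_sub_cancel]
    · refine Finset.sum_congr rfl fun N hN => ?_
      simp only [zero_add, hQ0, one_add_one_eq_two]
      rw [← k1 N (by simp at hN; omega)]
      have hp : (((2 * N + 1 : ℕ) : ℝ)) ≠ 0 := by positivity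
      simp only [Nat.add_sub_cancel]
      field_simp
      ring
  intro t₁ h₁ t₂ h₂
  have hconst := isOpen_Ioo.is_const_of_deriv_eq_zero isPreconnected_Ioo
    (fun t ht => (hder t ht).differentiableAt.differentiableWithinAt)
    (fun t ht => (hder t ht).deriv) h₁ h₂
  simp only [sum_Icc_shift, ctr_sum, Nat.mul_add, Nat.add_sub_cancel, mul_one] 
  exact hconst
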